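/- Let Γ be a group acting freely and properly discontinuously by homeomorphisms on a path-connected topological space Ỹ, and let Φ ⊆ Ỹ be a Γ-fundamental domain. Then the set S_Φ = {γ ∈ Γ : γ ≠ 1, γ·cl(Φ) ∩ cl(Φ) ≠ ∅} is symmetric (closed under inversion) and generates Γ, i.e. the subgroup generated by S_Φ is all of Γ. -/

import Mathlib

open scoped Pointwise

/-- The set `S_Φ` of nontrivial `γ ∈ Γ` whose translate of the closure of `Φ` is adjacent
to the closure of `Φ`. -/
def adjSet {Γ Y : Type*} [Group Γ] [TopologicalSpace Y] [MulAction Γ Y] (Φ : Set Y) : Set Γ :=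
  {γ : Γ | γ ≠ 1 ∧ (γ • closure Φ) ∩ closure Φ ≠ ∅}

theorem inv_mem_adjSet {Γ Y : Type*} [Group Γ] [TopologicalSpace Y] [MulAction Γ Y] {Φ : Set Y}
    {γ : Γ} (hγ : γ ∈ adjSet (Γ := Γ) Φ) : γ⁻¹ ∈ adjSet (Γ := Γ) Φ := by
  obtain ⟨hne, hmeet⟩ := hγ
  obtain ⟨y, hy, hy'⟩ := Set.nonempty_iff_ne_empty.mpr hmeet
  exact ⟨inv_ne_one.mpr hne, Set.nonempty_iff_ne_empty.mp
    ⟨γ⁻¹ • y, Set.smul_mem_smul_set hy', Set.mem_smul_set_iff_inv_smul_mem.mp hy⟩⟩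

/-- Two translates of `closure Φ` that meet differ by an element of the subgroup generated by
`adjSet Φ`. -/
theorem inv_mul_mem_closure_adjSet {Γ Y : Type*} [Group Γ] [TopologicalSpace Y] [MulAction Γ Y]
    {Φ : Set Y} {g h : Γ} {y : Y} (hg : y ∈ g • closure Φ) (hh : y ∈ h • closure Φ) :
    g⁻¹ * h ∈ Subgroup.closure (adjSet (Γ := Γ) Φ) := by
  by_cases hne : g⁻¹ * h = 1
  · exact hne ▸ one_mem _
  · refine Subgroup.subset_closure ⟨hne, Set.nonempty_iff_ne_empty.mp ⟨g⁻¹ • y, ?_, ?_⟩⟩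
    · rw [mul_smul]
      exact Set.smul_mem_smul_set hh
    · exact Set.mem_smul_set_iff_inv_smul_mem.mp hg

/-- If every compact set meets only finitely many members of a family of closed sets, then the
preimage of any subunion under a continuous map from a compact space is closed. -/
theorem isClosed_preimage_biUnion_of_finite_inter_compact {ι X Y : Type*} [TopologicalSpace X]
    [CompactSpace X] [TopologicalSpace Y] {C : ι → Set Y} (hC : ∀ i, IsClosed (C i))
    (hlf : ∀ K : Set Y, IsCompact K → {i | C i ∩ K ≠ ∅}.Finite)
    {f : X → Y} (hf : Continuous f) (T : Set ι) : IsClosed (f ⁻¹' ⋃ i ∈ T, C i) := by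
  have hfin := (hlf _ (isCompact_range hf)).inter_of_right T
  have heq : (f ⁻¹' ⋃ i ∈ T, C i) =
      ⋃ i ∈ T ∩ {i | C i ∩ Set.range f ≠ ∅}, f ⁻¹' C i := by
    ext x
    simp only [Set.mem_preimage, Set.mem_iUnion, exists_prop]
    constructor
    · rintro ⟨i, hi, hx⟩
      exact ⟨i, ⟨hi, Set.nonempty_iff_ne_empty.mp ⟨f x, hx, x, rfl⟩⟩, hx⟩
    · rintro ⟨i, hi, hx⟩
      exact ⟨i, hi.1, hx⟩
  rw [heq]
  exact hfin.isClosed_biUnion fun i _ => (hC i).preimage hf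

theorem stmt3 {Γ Y : Type*} [Group Γ] [TopologicalSpace Y] [MulAction Γ Y]
    [PathConnectedSpace Y]
    -- Γ acts by homeomorphisms:
    [ContinuousConstSMul Γ Y]
    -- the action is properly discontinuous:
    [ProperlyDiscontinuousSMul Γ Y]
    -- the action is free:
    (hfree : ∀ (γ : Γ) (y : Y), γ • y = y → γ = 1)
    (Φ : Set Y)
    -- Φ is a domain (equal to the interior of its closure, in particular open):
    (hdom : Φ = interior (closure Φ))
    -- the translates of the closure of Φ cover Y:
    (hcover : (⋃ γ : Γ, γ • closure Φ) = Set.univ)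
    -- distinct translates of Φ are disjoint:
    (hdisj : ∀ γ : Γ, γ ≠ 1 → (γ • Φ) ∩ Φ = ∅)
    -- local finiteness of the translates of the closure of Φ:
    (hlf : ∀ K : Set Y, IsCompact K → {γ : Γ | (γ • closure Φ) ∩ K ≠ ∅}.Finite) :
    (∀ γ ∈ adjSet (Γ := Γ) Φ, γ⁻¹ ∈ adjSet (Γ := Γ) Φ) ∧
      Subgroup.closure (adjSet (Γ := Γ) Φ) = ⊤ := by
  refine ⟨fun γ hγ => inv_mem_adjSet hγ, ?_⟩
  set H := Subgroup.closure (adjSet (Γ := Γ) Φ)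
  have hcov (y : Y) : ∃ γ : Γ, y ∈ γ • closure Φ := by
    simpa using Set.eq_univ_iff_forall.mp hcover y
  obtain ⟨x, hx⟩ : (closure Φ).Nonempty := by
    obtain ⟨y⟩ := (inferInstance : Nonempty Y)
    obtain ⟨γ, hγ⟩ := hcov y
    exact ⟨_, Set.mem_smul_set_iff_inv_smul_mem.mp hγ⟩
  refine (Subgroup.eq_top_iff' H).mpr fun g => ?_
  let p := PathConnectedSpace.somePath x (g • x)
  have hclosed (T : Set Γ) : IsClosed (p ⁻¹' ⋃ γ ∈ T, γ • closure Φ) :=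
    isClosed_preimage_biUnion_of_finite_inter_compact
      (fun γ => isClosed_closure.smul γ) hlf p.continuous T
  have hcompl : (p ⁻¹' ⋃ γ ∈ (H : Set Γ), γ • closure Φ)ᶜ =
      p ⁻¹' ⋃ γ ∈ (H : Set Γ)ᶜ, γ • closure Φ := by
    ext t
    simp only [Set.mem_compl_iff, Set.mem_preimage, Set.mem_iUnion, exists_prop, SetLike.mem_coe]
    constructor
    · intro ht
      obtain ⟨γ, hγ⟩ := hcov (p t)
      exact ⟨γ, fun hmem => ht ⟨γ, hmem, hγ⟩, hγ⟩
    · rintro ⟨γ, hγ, ht⟩ ⟨h, hh, ht'⟩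
      exact hγ ((H.mul_mem_cancel_left (H.inv_mem hh)).mp (inv_mul_mem_closure_adjSet ht' ht))
  have hclopen : IsClopen (p ⁻¹' ⋃ γ ∈ (H : Set Γ), γ • closure Φ) :=
    ⟨hclosed _, isClosed_compl_iff.mp (hcompl ▸ hclosed _)⟩
  have huniv := hclopen.eq_univ ⟨0, by
    simp only [Set.mem_preimage, Set.mem_iUnion, p.source]
    exact ⟨1, H.one_mem, by simpa using hx⟩⟩
  have hone := Set.eq_univ_iff_forall.mp huniv 1
  simp only [Set.mem_preimage, Set.mem_iUnion, p.target, exists_prop, SetLike.mem_coe] at hone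
  obtain ⟨h, hh, hgx⟩ := hone
  exact (H.mul_mem_cancel_left (H.inv_mem hh)).mp
    (inv_mul_mem_closure_adjSet hgx (Set.smul_mem_smul_set hx))
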